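/- arXiv:1707.06206 — 2 statements merged into one kernel-verified Lean document; each statement's English description precedes it below -/
import Mathlib

section
/- Let q be a prime power and f(x) = x² − r x + s ∈ F_q[x] a monic irreducible quadratic. The loop (Q, ∘_f) is right conjugacy closed: for all v, w ∈ Q there exists u ∈ Q such that M_w⁻¹ · M_v · M_w = M_u; that is, the set of matrices {M_v : v ∈ Q} is closed under conjugation by its own elements. -/
open Polynomial Matrix
open scoped Classical

/-- The right-translation matrix `M_{(c,d)}`: `M_{(0,d)} = d·I` and, for `c ≠ 0`,
`M_{(c,d)}` has rows `(r - d, f(d)/(-c))` and `(c, d)`, where `f(x) = x² - r x + s`. -/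
noncomputable def Mmat {K : Type*} [Field K] (r s c d : K) : Matrix (Fin 2) (Fin 2) K :=
  if c = 0 then d • (1 : Matrix (Fin 2) (Fin 2) K)
  else !![r - d, (d ^ 2 - r * d + s) / (-c); c, d]

/-- The binary operation `v ∘_f w = v · M_{(w 0, w 1)}` on row vectors. -/
noncomputable def lmul {K : Type*} [Field K] (r s : K) (v w : Fin 2 → K) : Fin 2 → K :=
  Matrix.vecMul v (Mmat r s (w 0) (w 1))

section

variable {K : Type*} [Field K] {r s : K}

lemma eval_ne_zero_of_irreducible_quadratic
    (hf : Irreducible (X ^ 2 - C r * X + C s : K[X])) (x : K) : x ^ 2 - r * x + s ≠ 0 := by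
  intro hx
  have hroot : (X ^ 2 - C r * X + C s : K[X]).IsRoot x := by simpa using hx
  have h1 := degree_eq_one_of_irreducible_of_root hf hroot
  have h2 : (X ^ 2 - C r * X + C s : K[X]).degree = 2 := by compute_degree!
  rw [h2] at h1
  norm_num at h1

lemma Mmat_zero_left (d : K) : Mmat r s 0 d = d • (1 : Matrix (Fin 2) (Fin 2) K) := if_pos rfl

lemma trace_Mmat {c : K} (hc : c ≠ 0) (d : K) : (Mmat r s c d).trace = r := by
  simp [Mmat, hc, Matrix.trace_fin_two]

lemma det_Mmat {c : K} (hc : c ≠ 0) (d : K) : (Mmat r s c d).det = s := by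
  simp only [Mmat, hc, if_false, Matrix.det_fin_two_of]
  field_simp
  ring

lemma apply_one_zero_ne_zero (hf : ∀ x : K, x ^ 2 - r * x + s ≠ 0)
    {A : Matrix (Fin 2) (Fin 2) K} (htr : A.trace = r) (hdet : A.det = s) : A 1 0 ≠ 0 := by
  intro h
  rw [Matrix.trace_fin_two] at htr
  rw [Matrix.det_fin_two, h] at hdet
  exact hf (A 1 1) (by rw [← htr, ← hdet]; ring)

lemma eq_Mmat_of_trace_of_det {A : Matrix (Fin 2) (Fin 2) K} (htr : A.trace = r)
    (hdet : A.det = s) (hA : A 1 0 ≠ 0) : A = Mmat r s (A 1 0) (A 1 1) := by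
  rw [Matrix.trace_fin_two] at htr
  rw [Matrix.det_fin_two] at hdet
  rw [Mmat, if_neg hA]
  ext i j
  fin_cases i <;> fin_cases j
  · simp [← htr]
  · simp only [Fin.zero_eta, Fin.mk_one, Matrix.of_apply, Matrix.cons_val', Matrix.cons_val_zero,
      Matrix.cons_val_one, ← htr, ← hdet]
    field_simp
    ring
  · simp
  · simp

lemma isUnit_det_Mmat (hf : ∀ x : K, x ^ 2 - r * x + s ≠ 0) {w : Fin 2 → K} (hw : w ≠ 0) :
    IsUnit (Mmat r s (w 0) (w 1)).det := by
  rw [isUnit_iff_ne_zero]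
  by_cases h0 : w 0 = 0
  · have h1 : w 1 ≠ 0 := fun h1 => hw (by ext i; fin_cases i <;> simp [h0, h1])
    simp [h0, Mmat_zero_left, h1]
  · simpa [det_Mmat h0] using hf 0

end

/-- The loop `(Q, ∘_f)` is right conjugacy closed: for all nonzero
`v, w ∈ F_q²` there is a nonzero `u` with `M_w⁻¹ · M_v · M_w = M_u`. -/
theorem stmt_9 {K : Type*} [Field K] [Fintype K] (r s : K)
    (hf : Irreducible (X ^ 2 - C r * X + C s : K[X])) :
    ∀ v w : Fin 2 → K, v ≠ 0 → w ≠ 0 →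
      ∃ u : Fin 2 → K, u ≠ 0 ∧
        (Mmat r s (w 0) (w 1))⁻¹ * Mmat r s (v 0) (v 1) * Mmat r s (w 0) (w 1) =
          Mmat r s (u 0) (u 1) := by
  intro v w hv hw
  have hroot := eval_ne_zero_of_irreducible_quadratic hf
  have hM := isUnit_det_Mmat hroot hw
  set M := Mmat r s (w 0) (w 1)
  by_cases h0 : v 0 = 0
  · refine ⟨v, hv, ?_⟩
    simp [h0, Mmat_zero_left, Matrix.nonsing_inv_mul M hM]
  · set A := M⁻¹ * Mmat r s (v 0) (v 1) * M
    have hM' := (Matrix.isUnit_iff_isUnit_det M).2 hM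
    have htr : A.trace = r := by rw [Matrix.trace_conj' hM', trace_Mmat h0]
    have hdet : A.det = s := by rw [Matrix.det_conj' hM', det_Mmat h0]
    have hA := apply_one_zero_ne_zero hroot htr hdet
    exact ⟨![A 1 0, A 1 1], fun h => hA (congrFun h 0), eq_Mmat_of_trace_of_det htr hdet hA⟩
end

section
/- Let q be a prime power and f(x) = x² − r x + s ∈ F_q[x] a monic irreducible quadratic with r ≠ 0. Then the loop (Q, ∘_f) is simple: its only normal subloops are {(0,1)} and Q. -/
open Polynomial Matrix
open scoped Classical

/-- `x ∘ S`: the elementwise left product of `x` with the set `S`. -/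
noncomputable def lmulSetL {K : Type*} [Field K] (r s : K) (x : Fin 2 → K)
    (S : Set (Fin 2 → K)) : Set (Fin 2 → K) :=
  (fun n => lmul r s x n) '' S

/-- `S ∘ x`: the elementwise right product of the set `S` with `x`. -/
noncomputable def lmulSetR {K : Type*} [Field K] (r s : K) (S : Set (Fin 2 → K))
    (x : Fin 2 → K) : Set (Fin 2 → K) :=
  (fun n => lmul r s n x) '' S

/-- A subloop of `(Q, ∘_f)`: a nonempty subset of `Q = F_q² \ {0}` closed under the
multiplication and under both divisions. -/
def IsSubloop {K : Type*} [Field K] (r s : K) (N : Set (Fin 2 → K)) : Prop :=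
  N.Nonempty ∧ N ⊆ {v | v ≠ 0} ∧
  (∀ a ∈ N, ∀ b ∈ N, lmul r s a b ∈ N) ∧
  (∀ a ∈ N, ∀ b ∈ N, ∀ x : Fin 2 → K, x ≠ 0 → lmul r s a x = b → x ∈ N) ∧
  (∀ a ∈ N, ∀ b ∈ N, ∀ y : Fin 2 → K, y ≠ 0 → lmul r s y a = b → y ∈ N)

/-- A normal subloop of `(Q, ∘_f)`: a subloop `N` such that for all `x, y ∈ Q`
(with products of sets taken elementwise) `x∘N = N∘x`, `x∘(y∘N) = (x∘y)∘N`,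
`(N∘x)∘y = N∘(x∘y)` and `x∘(N∘y) = (x∘N)∘y`. -/
def IsNormalSubloop {K : Type*} [Field K] (r s : K) (N : Set (Fin 2 → K)) : Prop :=
  IsSubloop r s N ∧
  ∀ x : Fin 2 → K, x ≠ 0 → ∀ y : Fin 2 → K, y ≠ 0 →
    lmulSetL r s x N = lmulSetR r s N x ∧
    lmulSetL r s x (lmulSetL r s y N) = lmulSetL r s (lmul r s x y) N ∧
    lmulSetR r s (lmulSetR r s N x) y = lmulSetR r s N (lmul r s x y) ∧
    lmulSetL r s x (lmulSetR r s N y) = lmulSetR r s (lmulSetL r s x N) y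

theorem no_root_of_irreducible_quadratic {K : Type*} [Field K] {r s : K}
    (hf : Irreducible (X ^ 2 - C r * X + C s : K[X])) (x : K) : x ^ 2 - r * x + s ≠ 0 := by
  intro hx
  have hroot : IsRoot (X ^ 2 - C r * X + C s : K[X]) x := by simpa using hx
  have h1 := degree_eq_one_of_irreducible_of_root hf hroot
  have h2 : (X ^ 2 - C r * X + C s : K[X]).degree = 2 := by compute_degree!
  rw [h1] at h2
  exact absurd h2 (by decide)

theorem binary_form_ne_zero {K : Type*} [Field K] {r s : K}
    (hs : ∀ x : K, x ^ 2 - r * x + s ≠ 0) {a b : K} (hab : a ≠ 0 ∨ b ≠ 0) :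
    b ^ 2 - r * a * b + s * a ^ 2 ≠ 0 := by
  by_cases ha : a = 0
  · subst ha
    simpa using hab
  · intro h
    apply hs (b / a)
    field_simp
    linear_combination h

theorem lmul_apply_of_ne {K : Type*} [Field K] {r s : K} (v w : Fin 2 → K) (hw : w 0 ≠ 0) :
    lmul r s v w = ![v 0 * (r - w 1) + v 1 * w 0,
      v 0 * ((w 1 ^ 2 - r * w 1 + s) / (-w 0)) + v 1 * w 1] := by
  ext i
  fin_cases i <;> simp [lmul, Mmat, hw, vecMul, dotProduct, Fin.sum_univ_two]

theorem lmul_of_eq_zero {K : Type*} [Field K] {r s : K} (v w : Fin 2 → K) (hw : w 0 = 0) :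
    lmul r s v w = w 1 • v := by
  simp [lmul, Mmat, hw, vecMul_smul]

theorem lmul_one_right {K : Type*} [Field K] (r s : K) (v : Fin 2 → K) :
    lmul r s v ![0, 1] = v := by
  rw [lmul_of_eq_zero _ _ rfl]
  exact one_smul K v

theorem lmul_one_left {K : Type*} [Field K] (r s : K) (w : Fin 2 → K) :
    lmul r s ![0, 1] w = w := by
  by_cases hw : w 0 = 0
  · rw [lmul_of_eq_zero _ _ hw]
    ext i
    fin_cases i <;> simp [hw]
  · rw [lmul_apply_of_ne _ _ hw]
    ext i
    fin_cases i <;> simp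

theorem exists_lmul_right_eq {K : Type*} [Field K] {r s : K} (hs : s ≠ 0) (v : Fin 2 → K)
    {w : Fin 2 → K} (hw : w 0 ≠ 0) : ∃ y : Fin 2 → K, lmul r s y w = v := by
  refine ⟨![(v 0 * w 1 - v 1 * w 0) / s,
    (v 0 * ((w 1 ^ 2 - r * w 1 + s) / w 0) + v 1 * (r - w 1)) / s], ?_⟩
  rw [lmul_apply_of_ne _ _ hw]
  ext i
  fin_cases i <;> simp <;> field_simp <;> ring

theorem lmul_smul_add_smul {K : Type*} [Field K] {r s : K} (a b : K) (u v w : Fin 2 → K) :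
    lmul r s (a • u + b • v) w = a • lmul r s u w + b • lmul r s v w := by
  simp [lmul, add_vecMul, smul_vecMul]

theorem smul_add_smul_ne_zero {K : Type*} [Field K] {u v : Fin 2 → K}
    (hD : u 0 * v 1 - u 1 * v 0 ≠ 0) {a b : K} (hab : a ≠ 0 ∨ b ≠ 0) : a • u + b • v ≠ 0 := by
  intro h
  have h0 : a * u 0 + b * v 0 = 0 := by simpa using congrFun h 0
  have h1 : a * u 1 + b * v 1 = 0 := by simpa using congrFun h 1
  rcases hab with ha | hb
  · exact mul_ne_zero ha hD (by linear_combination v 1 * h0 - v 0 * h1)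
  · exact mul_ne_zero hb hD (by linear_combination u 0 * h1 - u 1 * h0)

/-- Two independent vectors `u`, `w` determine a right translation sending `u` to `w`;
by Cayley-Hamilton it sends `w` to `r w - s u`. -/
theorem exists_lmul_eq {K : Type*} [Field K] {r s : K}
    (hs : ∀ x : K, x ^ 2 - r * x + s ≠ 0) {u w : Fin 2 → K}
    (hD : u 0 * w 1 - u 1 * w 0 ≠ 0) :
    ∃ y : Fin 2 → K, y ≠ 0 ∧ lmul r s u y = w ∧ lmul r s w y = r • w + (-s) • u := by
  have hQ : w 0 ^ 2 - r * u 0 * w 0 + s * u 0 ^ 2 ≠ 0 := by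
    apply binary_form_ne_zero hs
    by_contra! h
    exact hD (by simp [h.1, h.2])
  obtain ⟨D, hDe⟩ : ∃ D, D = u 0 * w 1 - u 1 * w 0 := ⟨_, rfl⟩
  obtain ⟨E, hE⟩ : ∃ E, E = w 0 ^ 2 - r * u 0 * w 0 + s * u 0 ^ 2 := ⟨_, rfl⟩
  obtain ⟨F, hF⟩ : ∃ F, F = u 0 * (r * w 1 - s * u 1) - w 0 * w 1 := ⟨_, rfl⟩
  rw [← hDe] at hD
  rw [← hE] at hQ
  have hy : (![-E / D, F / D] : Fin 2 → K) 0 ≠ 0 := by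
    simpa using ⟨hQ, hD⟩
  refine ⟨![-E / D, F / D], fun h => hy (congrFun h 0), ?_, ?_⟩
  · rw [lmul_apply_of_ne _ _ hy]
    ext i
    fin_cases i <;> simp <;> field_simp <;> subst hDe hE hF <;> ring
  · rw [lmul_apply_of_ne _ _ hy]
    ext i
    fin_cases i <;> simp <;> field_simp <;> subst hDe hE hF <;> ring

section Invariant

variable {K α : Type*} [Field K] {r s : K} {g : (Fin 2 → K) → α}

theorem smul_invariant
    (hg : ∀ a b y : Fin 2 → K, a ≠ 0 → b ≠ 0 → y ≠ 0 → g a = g b →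
      g (lmul r s a y) = g (lmul r s b y))
    {a b : Fin 2 → K} (ha : a ≠ 0) (hb : b ≠ 0) {k : K} (hk : k ≠ 0) (h : g a = g b) :
    g (k • a) = g (k • b) := by
  have := hg a b ![0, k] ha hb (fun h => hk (by simpa using congrFun h 1)) h
  rwa [lmul_of_eq_zero _ _ rfl, lmul_of_eq_zero _ _ rfl] at this

theorem invariant_smul_add (hs : ∀ x : K, x ^ 2 - r * x + s ≠ 0)
    (hg : ∀ a b y : Fin 2 → K, a ≠ 0 → b ≠ 0 → y ≠ 0 → g a = g b →
      g (lmul r s a y) = g (lmul r s b y))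
    {u v : Fin 2 → K} (hD : u 0 * v 1 - u 1 * v 0 ≠ 0) (h : g u = g v)
    {m n : K} (hm : m ≠ 0) (hn : n ≠ 0) :
    g u = g ((n * r * (1 - m)) • u + m ^ 2 • v) := by
  have hs0 : s ≠ 0 := by simpa using hs 0
  have hu : u ≠ 0 := by rintro rfl; simp at hD
  have hv : v ≠ 0 := by rintro rfl; simp at hD
  have hD₁ : u 0 * (n⁻¹ • v) 1 - u 1 * (n⁻¹ • v) 0 ≠ 0 := by
    have := mul_ne_zero (inv_ne_zero hn) hD
    intro h0
    apply this
    simp at h0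
    linear_combination h0
  obtain ⟨y, hy, huy, hwy⟩ := exists_lmul_eq hs hD₁
  have hvy : lmul r s v y = r • v + (-(n * s)) • u := by
    have := lmul_smul_add_smul (r := r) (s := s) n 0 (n⁻¹ • v) v y
    rw [hwy, zero_smul, zero_smul, add_zero, add_zero, smul_smul, mul_inv_cancel₀ hn,
      one_smul] at this
    rw [this]
    ext i
    simp
    field_simp
  have h₁ := hg u v y hu hv hy h
  rw [huy, hvy] at h₁
  have hD₂ : (n⁻¹ • v) 0 * ((s / m) • u) 1 - (n⁻¹ • v) 1 * ((s / m) • u) 0 ≠ 0 := by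
    have := mul_ne_zero (div_ne_zero hs0 hm) hD₁
    intro h0
    apply this
    simp only [Pi.smul_apply, smul_eq_mul] at h0 ⊢
    linear_combination -h0
  obtain ⟨z, hz, hwz, huz⟩ := exists_lmul_eq hs hD₂
  have h₂ := hg _ _ z (smul_ne_zero (inv_ne_zero hn) hv)
    (by rw [add_comm]; exact smul_add_smul_ne_zero hD
          (Or.inl (neg_ne_zero.2 (mul_ne_zero hn hs0)))) hz h₁
  have hcomb : r • v + (-(n * s)) • u = (n * r) • (n⁻¹ • v) + (-(n * m)) • ((s / m) • u) := by
    ext i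
    simp
    field_simp
  have himg : lmul r s (r • v + (-(n * s)) • u) z =
      (s / m) • ((n * r * (1 - m)) • u + m ^ 2 • v) := by
    rw [hcomb, lmul_smul_add_smul, hwz, huz]
    ext i
    simp
    field_simp
    ring
  rw [hwz, himg] at h₂
  have hk : s / m ≠ 0 := div_ne_zero hs0 hm
  have h₃ := smul_invariant hg (smul_ne_zero hk hu)
    (smul_ne_zero hk (smul_add_smul_ne_zero hD (Or.inr (pow_ne_zero 2 hm)))) (inv_ne_zero hk) h₂
  simpa only [smul_smul _ (s / m), inv_mul_cancel₀ hk, one_smul] using h₃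

theorem invariant_add_smul (hs : ∀ x : K, x ^ 2 - r * x + s ≠ 0) (hr : r ≠ 0)
    (hg : ∀ a b y : Fin 2 → K, a ≠ 0 → b ≠ 0 → y ≠ 0 → g a = g b →
      g (lmul r s a y) = g (lmul r s b y))
    {u v : Fin 2 → K} (hD : u 0 * v 1 - u 1 * v 0 ≠ 0) (h : g u = g v) (t : K) :
    g u = g (v + t • u) := by
  by_cases ht : t = 0
  · simpa [ht] using h
  by_cases hK : ∃ m : K, m ≠ 0 ∧ m ≠ 1
  · obtain ⟨m, hm, hm1⟩ := hK
    have hm' : 1 - m ≠ 0 := sub_ne_zero.2 hm1.symm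
    have hmi : 1 - m⁻¹ ≠ 0 := sub_ne_zero.2 fun h => hm1 (by simpa using h.symm)
    have h₁ := invariant_smul_add (r := r) (s := s) (m := m)
      (n := m ^ 2 * (t * (1 - m)) / (r * (1 - m))) hs hg hD h hm
      (div_ne_zero (mul_ne_zero (pow_ne_zero 2 hm) (mul_ne_zero ht hm')) (mul_ne_zero hr hm'))
    have hD₁ : u 0 * ((m ^ 2 * (t * (1 - m)) / (r * (1 - m)) * r * (1 - m)) • u + m ^ 2 • v) 1
        - u 1 * ((m ^ 2 * (t * (1 - m)) / (r * (1 - m)) * r * (1 - m)) • u + m ^ 2 • v) 0 ≠ 0 := by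
      have := mul_ne_zero (pow_ne_zero 2 hm) hD
      intro h0
      apply this
      rw [← h0]
      simp
      ring
    have h₂ := invariant_smul_add (r := r) (s := s) (m := m⁻¹)
      (n := t * m / (r * (1 - m⁻¹))) hs hg hD₁ h₁ (inv_ne_zero hm)
      (div_ne_zero (mul_ne_zero ht hm) (mul_ne_zero hr hmi))
    rw [h₂]
    congr 1
    have e₁ : t * m / (r * (1 - m⁻¹)) * r * (1 - m⁻¹) = t * m := by
      rw [mul_assoc, div_mul_cancel₀ _ (mul_ne_zero hr hmi)]
    have e₂ : m ^ 2 * (t * (1 - m)) / (r * (1 - m)) * r * (1 - m) = m ^ 2 * (t * (1 - m)) := by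
      rw [mul_assoc, div_mul_cancel₀ _ (mul_ne_zero hr hm')]
    rw [e₁, e₂]
    ext i
    simp
    field_simp
    ring
  · push Not at hK
    have hs0 : s ≠ 0 := by simpa using hs 0
    have hu : u ≠ 0 := by rintro rfl; simp at hD
    have hv : v ≠ 0 := by rintro rfl; simp at hD
    obtain ⟨y, hy, huy, hvy⟩ := exists_lmul_eq hs hD
    have h₁ := hg u v y hu hv hy h
    rw [huy, hvy, hK r hr, hK (-s) (neg_ne_zero.2 hs0), one_smul] at h₁
    rw [hK t ht, h, h₁]

theorem invariant_eq_of_independent (hs : ∀ x : K, x ^ 2 - r * x + s ≠ 0) (hr : r ≠ 0)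
    (hg : ∀ a b y : Fin 2 → K, a ≠ 0 → b ≠ 0 → y ≠ 0 → g a = g b →
      g (lmul r s a y) = g (lmul r s b y))
    {u v : Fin 2 → K} (hD : u 0 * v 1 - u 1 * v 0 ≠ 0) (h : g u = g v)
    {a b : K} (hab : a ≠ 0 ∨ b ≠ 0) : g u = g (a • u + b • v) := by
  have key := @invariant_add_smul K α _ r s g hs hr hg
  by_cases hb : b = 0
  · subst hb
    have ha : a ≠ 0 := by simpa using hab
    have h₁ := key hD h a
    have hD₁ : v 0 * (v + a • u) 1 - v 1 * (v + a • u) 0 ≠ 0 := by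
      have := mul_ne_zero ha hD
      intro h0
      apply this
      simp at h0
      linear_combination -h0
    have h₂ := key hD₁ (h.symm.trans h₁) (-1)
    rw [h, h₂]
    congr 1
    module
  · have h₁ := key hD h ((a - 1) / b)
    have hD₁ : (v + ((a - 1) / b) • u) 0 * u 1 - (v + ((a - 1) / b) • u) 1 * u 0 ≠ 0 := by
      intro h0
      apply hD
      simp at h0
      linear_combination -h0
    have h₂ := key hD₁ h₁.symm b
    rw [h₁, h₂]
    congr 1
    ext i
    simp
    field_simp
    ring

end Invariant

/-- If `r ≠ 0`, the loop `(Q, ∘_f)` is simple: its only normal subloops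
are the trivial subloop `{(0,1)}` and `Q` itself. -/
theorem stmt_13 {K : Type*} [Field K] [Fintype K] (r s : K)
    (hf : Irreducible (X ^ 2 - C r * X + C s : K[X])) (hr : r ≠ 0)
    (N : Set (Fin 2 → K)) (hN : IsNormalSubloop r s N) :
    N = {![0, 1]} ∨ N = {v : Fin 2 → K | v ≠ 0} := by
  have hs := no_root_of_irreducible_quadratic hf
  have hs0 : s ≠ 0 := by simpa using hs 0
  obtain ⟨⟨⟨a₀, ha₀⟩, hsub, hmul, hldiv, hrdiv⟩, hnorm⟩ := hN
  have he0 : (![0, 1] : Fin 2 → K) ≠ 0 := fun h => one_ne_zero (α := K) (by simpa using congrFun h 1)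
  have he : (![0, 1] : Fin 2 → K) ∈ N :=
    hldiv a₀ ha₀ a₀ ha₀ _ he0 (lmul_one_right r s a₀)
  by_cases hline : ∀ n ∈ N, n 0 = 0
  · left
    apply Set.eq_singleton_iff_unique_mem.2 ⟨he, fun n hn => ?_⟩
    have hn0 := hline n hn
    have hn1 : n 1 ≠ 0 := fun h => hsub hn (by ext i; fin_cases i <;> simp [hn0, h])
    have hx : (![1, 0] : Fin 2 → K) ≠ 0 := fun h => one_ne_zero (α := K) (by simpa using congrFun h 0)
    obtain ⟨-, -, -, h4⟩ := hnorm ![1, 0] hx ![1, 0] hx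
    have hmem : lmul r s ![1, 0] (lmul r s n ![1, 0]) ∈
        lmulSetL r s ![1, 0] (lmulSetR r s N ![1, 0]) :=
      ⟨_, ⟨n, hn, rfl⟩, rfl⟩
    rw [h4] at hmem
    obtain ⟨_, ⟨m, hm, rfl⟩, heq⟩ := hmem
    have hny : lmul r s n ![1, 0] = ![n 1, 0] := by
      rw [lmul_apply_of_ne _ _ (by simp)]
      simp [hn0]
    simp only at heq
    rw [hny, lmul_of_eq_zero _ m (hline m hm), lmul_apply_of_ne _ _ (by simp),
      lmul_apply_of_ne _ _ (by simpa using hn1)] at heq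
    have h0 := congrFun heq 0
    have h1 := congrFun heq 1
    simp at h0 h1
    have hm1 : m 1 = 1 := mul_right_cancel₀ hr (by rw [h0, one_mul])
    rw [hm1] at h1
    have hn1' : n 1 = 1 := by
      field_simp at h1
      exact neg_injective h1
    ext i
    fin_cases i <;> simp [hn0, hn1']
  · right
    push Not at hline
    obtain ⟨n, hn, hn0⟩ := hline
    have hg : ∀ a b y : Fin 2 → K, a ≠ 0 → b ≠ 0 → y ≠ 0 →
        lmulSetR r s N a = lmulSetR r s N b →
        lmulSetR r s N (lmul r s a y) = lmulSetR r s N (lmul r s b y) := by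
      intro a b y ha hb hy hab
      rw [← (hnorm a ha y hy).2.2.1, ← (hnorm b hb y hy).2.2.1, hab]
    have hNe : lmulSetR r s N ![0, 1] = N := by
      simp [lmulSetR, lmul_one_right]
    have hD : (![0, 1] : Fin 2 → K) 0 * n 1 - (![0, 1] : Fin 2 → K) 1 * n 0 ≠ 0 := by
      simpa using hn0
    have hNn : lmulSetR r s N n = N := by
      apply Set.Subset.antisymm
      · rintro _ ⟨m, hm, rfl⟩
        exact hmul m hm n hn
      · intro m hm
        obtain ⟨y, hy⟩ := exists_lmul_right_eq hs0 m hn0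
        have hy0 : y ≠ 0 := by
          rintro rfl
          exact hsub hm (by rw [← hy]; simp [lmul])
        exact ⟨y, hrdiv n hn m hm y hy0 hy, hy⟩
    apply Set.Subset.antisymm hsub
    intro x hx
    have hab : x 1 - x 0 / n 0 * n 1 ≠ 0 ∨ x 0 / n 0 ≠ 0 := by
      by_contra! h
      have h0 : x 0 = 0 := by simpa [hn0] using h.2
      apply hx
      ext i
      fin_cases i
      · simpa using h0
      · simpa [h0] using h.1
    have hxN := invariant_eq_of_independent (g := lmulSetR r s N) hs hr hg hD
      (hNe.trans hNn.symm) hab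
    have hxe : (x 1 - x 0 / n 0 * n 1) • (![0, 1] : Fin 2 → K) + (x 0 / n 0) • n = x := by
      ext i
      fin_cases i <;> simp [hn0]
    rw [hNe, hxe] at hxN
    rw [hxN]
    exact ⟨![0, 1], he, lmul_one_left r s x⟩
end
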